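/- Let d ≥ 1, let P be a compactly supported probability measure on ℝ^d, and let σ > 0. For any two bounded measurable functions g₁, g₂ : ℝ^d → ℝ^d, one has ℓ_denoise(g₁) ≤ ℓ_denoise(g₂) if and only if ℓ_direct(g₁) ≤ ℓ_direct(g₂); in particular, minimizing the denoising objective over any class of bounded measurable functions is equivalent to minimizing the direct score-matching objective over that class. -/

import Mathlib

open MeasureTheory Real Filter Topology
open scoped InnerProductSpace ENNReal BigOperators

/-- The Gaussian kernel `q_σ(y, x) = (2πσ²)^{-d/2} exp(−‖y − x‖²/(2σ²))` on `ℝ^d`. -/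
noncomputable def gaussKernel (d : ℕ) (σ : ℝ) (y x : EuclideanSpace ℝ (Fin d)) : ℝ :=
  (2 * π * σ ^ 2) ^ (-(d : ℝ) / 2) * Real.exp (-‖y - x‖ ^ 2 / (2 * σ ^ 2))

/-- The smoothed density `Q_σ(y) = ∫ q_σ(y, x) dP(x)`. -/
noncomputable def smoothedDensity (d : ℕ) (σ : ℝ)
    (P : Measure (EuclideanSpace ℝ (Fin d))) (y : EuclideanSpace ℝ (Fin d)) : ℝ :=
  ∫ x, gaussKernel d σ y x ∂P

/-- The score `∇ log Q_σ` of the smoothed density. -/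
noncomputable def score (d : ℕ) (σ : ℝ) (P : Measure (EuclideanSpace ℝ (Fin d)))
    (y : EuclideanSpace ℝ (Fin d)) : EuclideanSpace ℝ (Fin d) :=
  gradient (fun z => Real.log (smoothedDensity d σ P z)) y

/-- The direct score-matching objective `ℓ_direct(g) = ∫ ½‖g(y) − ∇log Q_σ(y)‖² Q_σ(y) dy`. -/
noncomputable def lDirect (d : ℕ) (σ : ℝ) (P : Measure (EuclideanSpace ℝ (Fin d)))
    (g : EuclideanSpace ℝ (Fin d) → EuclideanSpace ℝ (Fin d)) : ℝ :=
  ∫ y, (1 / 2 : ℝ) * ‖g y - score d σ P y‖ ^ 2 * smoothedDensity d σ P y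

/-- The denoising score-matching objective
`ℓ_denoise(g) = ∫ (∫ ½‖g(y) − (x − y)/σ²‖² q_σ(y, x) dy) dP(x)`. -/
noncomputable def lDenoise (d : ℕ) (σ : ℝ) (P : Measure (EuclideanSpace ℝ (Fin d)))
    (g : EuclideanSpace ℝ (Fin d) → EuclideanSpace ℝ (Fin d)) : ℝ :=
  ∫ x, (∫ y, (1 / 2 : ℝ) * ‖g y - (σ ^ 2)⁻¹ • (x - y)‖ ^ 2 * gaussKernel d σ y x) ∂P

section GaussianSmoothing

variable {d : ℕ} {σ : ℝ}

lemma gaussKernel_nonneg (y x : EuclideanSpace ℝ (Fin d)) : 0 ≤ gaussKernel d σ y x := by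
  unfold gaussKernel
  positivity

lemma gaussKernel_pos (hσ : 0 < σ) (y x : EuclideanSpace ℝ (Fin d)) :
    0 < gaussKernel d σ y x := by
  unfold gaussKernel
  positivity

lemma continuous_gaussKernel :
    Continuous fun p : EuclideanSpace ℝ (Fin d) × EuclideanSpace ℝ (Fin d) =>
      gaussKernel d σ p.1 p.2 := by
  unfold gaussKernel
  fun_prop

/-- A quadratic factor costs at most half of the Gaussian decay rate. -/
lemma one_add_sq_mul_gaussKernel_le (d : ℕ) (hσ : 0 < σ) :
    ∃ C : ℝ, 0 ≤ C ∧ ∀ y x : EuclideanSpace ℝ (Fin d),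
      (1 + ‖y - x‖ ^ 2) * gaussKernel d σ y x ≤
        C * Real.exp (-(4 * σ ^ 2)⁻¹ * ‖y - x‖ ^ 2) := by
  refine ⟨(1 + 4 * σ ^ 2) * (2 * π * σ ^ 2) ^ (-(d : ℝ) / 2), by positivity, fun y x => ?_⟩
  unfold gaussKernel
  set t := (4 * σ ^ 2)⁻¹ * ‖y - x‖ ^ 2 with ht
  have ht0 : 0 ≤ t := by positivity
  have hu : ‖y - x‖ ^ 2 = 4 * σ ^ 2 * t := by rw [ht]; field_simp
  have hexp : -‖y - x‖ ^ 2 / (2 * σ ^ 2) = -t + -t := by rw [hu]; field_simp; ring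
  have hone : Real.exp (-t) ≤ 1 := Real.exp_le_one_iff.2 (by linarith)
  have hlin : t * Real.exp (-t) ≤ 1 := by
    rw [Real.exp_neg, ← div_eq_mul_inv, div_le_one (Real.exp_pos t)]
    linarith [Real.add_one_le_exp t]
  rw [hexp, Real.exp_add, neg_mul, ← ht, hu]
  have hfac : (1 + 4 * σ ^ 2 * t) * Real.exp (-t) ≤ 1 + 4 * σ ^ 2 := by
    nlinarith [mul_le_mul_of_nonneg_left hlin (by positivity : 0 ≤ 4 * σ ^ 2)]
  calc _ = ((1 + 4 * σ ^ 2 * t) * Real.exp (-t)) *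
        ((2 * π * σ ^ 2) ^ (-(d : ℝ) / 2) * Real.exp (-t)) := by ring
    _ ≤ (1 + 4 * σ ^ 2) * ((2 * π * σ ^ 2) ^ (-(d : ℝ) / 2) * Real.exp (-t)) := by gcongr
    _ = _ := by ring

lemma exists_one_add_sq_mul_gaussKernel_le_const (d : ℕ) (hσ : 0 < σ) :
    ∃ C : ℝ, ∀ y x : EuclideanSpace ℝ (Fin d),
      (1 + ‖y - x‖ ^ 2) * gaussKernel d σ y x ≤ C := by
  obtain ⟨C, hC, h⟩ := one_add_sq_mul_gaussKernel_le d hσ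
  refine ⟨C, fun y x => (h y x).trans (mul_le_of_le_one_right hC (Real.exp_le_one_iff.2 ?_))⟩
  rw [neg_mul]
  exact neg_nonpos.2 (by positivity)

lemma integrable_one_add_sq_mul_gaussKernel (hσ : 0 < σ)
    (P : Measure (EuclideanSpace ℝ (Fin d))) [IsProbabilityMeasure P] :
    Integrable (fun p : EuclideanSpace ℝ (Fin d) × EuclideanSpace ℝ (Fin d) =>
      (1 + ‖p.2 - p.1‖ ^ 2) * gaussKernel d σ p.2 p.1) (P.prod volume) := by
  obtain ⟨C, hC, h⟩ := one_add_sq_mul_gaussKernel_le d hσ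
  have hmeas : Continuous fun p : EuclideanSpace ℝ (Fin d) × EuclideanSpace ℝ (Fin d) =>
      (1 + ‖p.2 - p.1‖ ^ 2) * gaussKernel d σ p.2 p.1 := by
    unfold gaussKernel
    fun_prop
  have hG : Integrable (fun u : EuclideanSpace ℝ (Fin d) =>
      Real.exp (-(4 * σ ^ 2)⁻¹ * ‖u‖ ^ 2)) := by
    have := (GaussianFourier.integrable_cexp_neg_mul_sq_norm_add
      (V := EuclideanSpace ℝ (Fin d)) (b := (((4 * σ ^ 2)⁻¹ : ℝ) : ℂ))
      (by rw [Complex.ofReal_re]; positivity) 0 0).re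
    refine this.congr (ae_of_all _ fun u => ?_)
    have hcast : (-(((4 * σ ^ 2)⁻¹ : ℝ) : ℂ) * (‖u‖ : ℂ) ^ 2) =
        ((-(4 * σ ^ 2)⁻¹ * ‖u‖ ^ 2 : ℝ) : ℂ) := by
      rw [Complex.ofReal_mul, Complex.ofReal_neg, Complex.ofReal_pow]
    simp only [zero_mul, add_zero, hcast, ← Complex.ofReal_exp]
    exact Complex.ofReal_re _
  have hprod : Integrable (fun p : EuclideanSpace ℝ (Fin d) × EuclideanSpace ℝ (Fin d) =>
      C * Real.exp (-(4 * σ ^ 2)⁻¹ * ‖p.2 - p.1‖ ^ 2)) (P.prod volume) := by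
    have hcont : Continuous fun p : EuclideanSpace ℝ (Fin d) × EuclideanSpace ℝ (Fin d) =>
        C * Real.exp (-(4 * σ ^ 2)⁻¹ * ‖p.2 - p.1‖ ^ 2) := by fun_prop
    rw [integrable_prod_iff hcont.aestronglyMeasurable]
    refine ⟨ae_of_all _ fun x => (hG.comp_sub_right x).const_mul C, ?_⟩
    have hconst (x : EuclideanSpace ℝ (Fin d)) :
        ∫ y, ‖C * Real.exp (-(4 * σ ^ 2)⁻¹ * ‖y - x‖ ^ 2)‖ =
          ∫ u : EuclideanSpace ℝ (Fin d), ‖C * Real.exp (-(4 * σ ^ 2)⁻¹ * ‖u‖ ^ 2)‖ :=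
      integral_sub_right_eq_self
        (fun u : EuclideanSpace ℝ (Fin d) => ‖C * Real.exp (-(4 * σ ^ 2)⁻¹ * ‖u‖ ^ 2)‖) x
    simp only [hconst]
    exact integrable_const _
  refine hprod.mono' hmeas.aestronglyMeasurable (ae_of_all _ fun p => ?_)
  rw [Real.norm_of_nonneg (mul_nonneg (by positivity) (gaussKernel_nonneg _ _))]
  exact h _ _

/-- The quadratic error against `(x - y) / σ²` has at most quadratic growth in `y - x`. -/
lemma half_sq_norm_sub_le (a x y : EuclideanSpace ℝ (Fin d)) {C : ℝ} (ha : ‖a‖ ≤ C) :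
    (1 / 2 : ℝ) * ‖a - (σ ^ 2)⁻¹ • (x - y)‖ ^ 2 ≤
      (C ^ 2 + ((σ ^ 2)⁻¹) ^ 2) * (1 + ‖y - x‖ ^ 2) := by
  have h1 : ‖a - (σ ^ 2)⁻¹ • (x - y)‖ ≤ C + (σ ^ 2)⁻¹ * ‖y - x‖ := by
    refine (norm_sub_le _ _).trans ?_
    rw [norm_smul, norm_sub_rev x y, Real.norm_of_nonneg (by positivity)]
    gcongr
  have h2 := pow_le_pow_left₀ (norm_nonneg _) h1 2
  nlinarith [sq_nonneg (C - (σ ^ 2)⁻¹ * ‖y - x‖), sq_nonneg (C * ‖y - x‖),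
    sq_nonneg ((σ ^ 2)⁻¹)]

lemma integrable_denoising_integrand (hσ : 0 < σ)
    (P : Measure (EuclideanSpace ℝ (Fin d))) [IsProbabilityMeasure P]
    {g : EuclideanSpace ℝ (Fin d) → EuclideanSpace ℝ (Fin d)} (hg : Measurable g)
    {C : ℝ} (hC : ∀ y, ‖g y‖ ≤ C) :
    Integrable (fun p : EuclideanSpace ℝ (Fin d) × EuclideanSpace ℝ (Fin d) =>
      (1 / 2 : ℝ) * ‖g p.2 - (σ ^ 2)⁻¹ • (p.1 - p.2)‖ ^ 2 * gaussKernel d σ p.2 p.1)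
      (P.prod volume) := by
  have hq : Measurable fun p : EuclideanSpace ℝ (Fin d) × EuclideanSpace ℝ (Fin d) =>
      gaussKernel d σ p.2 p.1 := (continuous_gaussKernel.comp continuous_swap).measurable
  refine ((integrable_one_add_sq_mul_gaussKernel hσ P).const_mul
    (C ^ 2 + ((σ ^ 2)⁻¹) ^ 2)).mono' (by fun_prop) (ae_of_all _ fun p => ?_)
  rw [Real.norm_of_nonneg (mul_nonneg (by positivity) (gaussKernel_nonneg _ _)), ← mul_assoc]
  exact mul_le_mul_of_nonneg_right (half_sq_norm_sub_le _ _ _ (hC _)) (gaussKernel_nonneg _ _)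

variable (P : Measure (EuclideanSpace ℝ (Fin d))) [IsProbabilityMeasure P]

lemma continuous_gaussKernel_right (y : EuclideanSpace ℝ (Fin d)) :
    Continuous fun x => gaussKernel d σ y x := by
  unfold gaussKernel
  fun_prop

lemma integrable_gaussKernel (hσ : 0 < σ) (y : EuclideanSpace ℝ (Fin d)) :
    Integrable (fun x => gaussKernel d σ y x) P := by
  obtain ⟨C, h⟩ := exists_one_add_sq_mul_gaussKernel_le_const d hσ
  refine (integrable_const C).mono' (continuous_gaussKernel_right y).aestronglyMeasurable
    (ae_of_all _ fun x => ?_)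
  rw [Real.norm_of_nonneg (gaussKernel_nonneg _ _)]
  nlinarith [h y x, gaussKernel_nonneg (σ := σ) y x, sq_nonneg ‖y - x‖]

lemma smoothedDensity_pos (hσ : 0 < σ) (y : EuclideanSpace ℝ (Fin d)) :
    0 < smoothedDensity d σ P y := by
  unfold smoothedDensity
  rw [integral_pos_iff_support_of_nonneg (fun x => gaussKernel_nonneg y x)
    (integrable_gaussKernel P hσ y)]
  have : Function.support (fun x => gaussKernel d σ y x) = Set.univ :=
    Set.eq_univ_of_forall fun x => (gaussKernel_pos hσ y x).ne'
  simp [this]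

lemma exists_norm_gaussKernel_smul_le (d : ℕ) (hσ : 0 < σ) :
    ∃ C : ℝ, ∀ y x : EuclideanSpace ℝ (Fin d),
      ‖gaussKernel d σ y x • (σ ^ 2)⁻¹ • (x - y)‖ ≤ C := by
  obtain ⟨C, h⟩ := exists_one_add_sq_mul_gaussKernel_le_const d hσ
  refine ⟨(σ ^ 2)⁻¹ * C, fun y x => ?_⟩
  rw [norm_smul, norm_smul, Real.norm_of_nonneg (gaussKernel_nonneg _ _), norm_sub_rev x y,
    Real.norm_of_nonneg (by positivity : 0 ≤ (σ ^ 2)⁻¹), mul_left_comm]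
  gcongr
  refine le_trans ?_ (h y x)
  rw [mul_comm]
  exact mul_le_mul_of_nonneg_right (by nlinarith [sq_nonneg (‖y - x‖ - 1)])
    (gaussKernel_nonneg _ _)

lemma integrable_gaussKernel_smul (hσ : 0 < σ) (y : EuclideanSpace ℝ (Fin d)) :
    Integrable (fun x => gaussKernel d σ y x • (σ ^ 2)⁻¹ • (x - y)) P := by
  obtain ⟨C, h⟩ := exists_norm_gaussKernel_smul_le d hσ
  exact (integrable_const C).mono'
    ((continuous_gaussKernel_right y).smul (by fun_prop)).aestronglyMeasurable
    (ae_of_all _ fun x => h y x)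

lemma hasFDerivAt_gaussKernel (y x : EuclideanSpace ℝ (Fin d)) :
    HasFDerivAt (fun z => gaussKernel d σ z x)
      (innerSL ℝ (gaussKernel d σ y x • (σ ^ 2)⁻¹ • (x - y))) y := by
  unfold gaussKernel
  have h := (((((hasFDerivAt_id y).sub_const x).norm_sq).neg.mul_const
    ((2 * σ ^ 2)⁻¹)).exp).const_mul ((2 * π * σ ^ 2) ^ (-(d : ℝ) / 2))
  simp only [← div_eq_mul_inv] at h
  refine h.congr_fderiv ?_
  ext w
  rw [← neg_sub y x]
  simp only [id, Pi.neg_apply, smul_apply, neg_apply,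
    ContinuousLinearMap.comp_apply, ContinuousLinearMap.id_apply, innerSL_apply_apply,
    real_inner_smul_left, inner_neg_left, smul_eq_mul]
  field_simp
  ring

lemma hasGradientAt_smoothedDensity (hσ : 0 < σ) (y : EuclideanSpace ℝ (Fin d)) :
    HasGradientAt (smoothedDensity d σ P)
      (∫ x, gaussKernel d σ y x • (σ ^ 2)⁻¹ • (x - y) ∂P) y := by
  obtain ⟨C, hC⟩ := exists_norm_gaussKernel_smul_le d hσ
  have hintegrable := integrable_gaussKernel_smul P hσ y
  have h := hasFDerivAt_integral_of_dominated_of_fderiv_le (μ := P) (𝕜 := ℝ)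
    (F := fun z x => gaussKernel d σ z x)
    (F' := fun z x => innerSL ℝ (gaussKernel d σ z x • (σ ^ 2)⁻¹ • (x - z)))
    (x₀ := y) (s := Set.univ) (bound := fun _ => C) Filter.univ_mem
    (Eventually.of_forall fun z => (continuous_gaussKernel_right z).aestronglyMeasurable)
    (integrable_gaussKernel P hσ y)
    ((innerSL ℝ).continuous.comp_aestronglyMeasurable hintegrable.aestronglyMeasurable)
    (ae_of_all _ fun x z _ => by rw [innerSL_apply_norm]; exact hC z x)
    (integrable_const C)
    (ae_of_all _ fun x z _ => hasFDerivAt_gaussKernel z x)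
  rw [ContinuousLinearMap.integral_comp_comm _ hintegrable] at h
  exact h

lemma score_eq (hσ : 0 < σ) (y : EuclideanSpace ℝ (Fin d)) :
    score d σ P y = (smoothedDensity d σ P y)⁻¹ •
      ∫ x, gaussKernel d σ y x • (σ ^ 2)⁻¹ • (x - y) ∂P := by
  have h := (hasGradientAt_smoothedDensity P hσ y).hasFDerivAt.log
    (smoothedDensity_pos P hσ y).ne'
  refine HasGradientAt.gradient ?_
  rw [hasGradientAt_iff_hasFDerivAt]
  simpa using h

lemma measurable_smoothedDensity : Measurable (smoothedDensity d σ P) :=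
  (StronglyMeasurable.integral_prod_right
    (continuous_gaussKernel (d := d) (σ := σ)).stronglyMeasurable).measurable

lemma measurable_score (hσ : 0 < σ) : Measurable (score d σ P) := by
  have hq := continuous_gaussKernel (d := d) (σ := σ)
  have hm : Continuous fun p : EuclideanSpace ℝ (Fin d) × EuclideanSpace ℝ (Fin d) =>
      gaussKernel d σ p.1 p.2 • (σ ^ 2)⁻¹ • (p.2 - p.1) := hq.smul (by fun_prop)
  rw [funext (score_eq P hσ)]
  exact (measurable_smoothedDensity P).inv.smul
    (StronglyMeasurable.integral_prod_right hm.stronglyMeasurable).measurable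

lemma integrable_half_sq_norm_sub_mul_gaussKernel (hσ : 0 < σ)
    (a y : EuclideanSpace ℝ (Fin d)) :
    Integrable (fun x => (1 / 2 : ℝ) * ‖a - (σ ^ 2)⁻¹ • (x - y)‖ ^ 2 * gaussKernel d σ y x)
      P := by
  obtain ⟨C, h⟩ := exists_one_add_sq_mul_gaussKernel_le_const d hσ
  have hq := continuous_gaussKernel_right (σ := σ) y
  refine (integrable_const ((‖a‖ ^ 2 + ((σ ^ 2)⁻¹) ^ 2) * C)).mono'
    (by fun_prop : Continuous _).aestronglyMeasurable (ae_of_all _ fun x => ?_)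
  rw [Real.norm_of_nonneg (mul_nonneg (by positivity) (gaussKernel_nonneg _ _))]
  refine (mul_le_mul_of_nonneg_right (half_sq_norm_sub_le a x y le_rfl)
    (gaussKernel_nonneg _ _)).trans ?_
  rw [mul_assoc]
  exact mul_le_mul_of_nonneg_left (h y x) (by positivity)

/-- Bias–variance decomposition: the score is the posterior mean of `(x - y) / σ²`. -/
lemma integral_half_sq_norm_sub_mul_gaussKernel (hσ : 0 < σ)
    (a y : EuclideanSpace ℝ (Fin d)) :
    ∫ x, (1 / 2 : ℝ) * ‖a - (σ ^ 2)⁻¹ • (x - y)‖ ^ 2 * gaussKernel d σ y x ∂P =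
      (1 / 2 : ℝ) * ‖a - score d σ P y‖ ^ 2 * smoothedDensity d σ P y +
      ∫ x, (1 / 2 : ℝ) * ‖score d σ P y - (σ ^ 2)⁻¹ • (x - y)‖ ^ 2 *
        gaussKernel d σ y x ∂P := by
  set s := score d σ P y with hs
  have hq := integrable_gaussKernel P hσ y
  have hqv := integrable_gaussKernel_smul P hσ y
  have hzero : ∫ x, (gaussKernel d σ y x • s - gaussKernel d σ y x • (σ ^ 2)⁻¹ • (x - y)) ∂P
      = 0 := by
    rw [integral_sub (hq.smul_const s) hqv, integral_smul_const, hs, score_eq P hσ]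
    exact sub_eq_zero.2 (smul_inv_smul₀ (smoothedDensity_pos P hσ y).ne' _)
  have hcross : Integrable (fun x => gaussKernel d σ y x • s -
      gaussKernel d σ y x • (σ ^ 2)⁻¹ • (x - y)) P := (hq.smul_const s).sub hqv
  have hexpand (x : EuclideanSpace ℝ (Fin d)) :
      (1 / 2 : ℝ) * ‖a - (σ ^ 2)⁻¹ • (x - y)‖ ^ 2 * gaussKernel d σ y x =
        ((1 / 2 : ℝ) * ‖a - s‖ ^ 2 * gaussKernel d σ y x +
        ⟪a - s, gaussKernel d σ y x • s - gaussKernel d σ y x • (σ ^ 2)⁻¹ • (x - y)⟫_ℝ) +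
        (1 / 2 : ℝ) * ‖s - (σ ^ 2)⁻¹ • (x - y)‖ ^ 2 * gaussKernel d σ y x := by
    rw [← sub_add_sub_cancel a s ((σ ^ 2)⁻¹ • (x - y)), norm_add_sq_real, ← smul_sub,
      real_inner_smul_right]
    ring
  simp only [hexpand]
  have hquad := hq.const_mul ((1 / 2 : ℝ) * ‖a - s‖ ^ 2)
  have hinner := hcross.const_inner (𝕜 := ℝ) (a - s)
  have hsum := hquad.add hinner
  simp only [Pi.add_def] at hsum
  rw [integral_add hsum (integrable_half_sq_norm_sub_mul_gaussKernel P hσ s y),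
    integral_add hquad hinner, integral_inner hcross, hzero,
    inner_zero_right, add_zero, integral_const_mul]
  rfl

/-- The two objectives differ by a constant independent of `g`. -/
lemma lDenoise_eq_lDirect_add (hσ : 0 < σ)
    {g : EuclideanSpace ℝ (Fin d) → EuclideanSpace ℝ (Fin d)} (hg : Measurable g)
    (hgb : ∃ C : ℝ, ∀ y, ‖g y‖ ≤ C) :
    lDenoise d σ P g = lDirect d σ P g +
      ∫ y, ∫ x, (1 / 2 : ℝ) * ‖score d σ P y - (σ ^ 2)⁻¹ • (x - y)‖ ^ 2 *
        gaussKernel d σ y x ∂P := by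
  obtain ⟨C, hC⟩ := hgb
  have hintegrable := integrable_denoising_integrand hσ P hg hC
  have hs := measurable_score P hσ
  have hQ := measurable_smoothedDensity (σ := σ) P
  have htotal := hintegrable.integral_prod_right
  simp only [integral_half_sq_norm_sub_mul_gaussKernel P hσ (g _)] at htotal
  have hdirect : Integrable fun y =>
      (1 / 2 : ℝ) * ‖g y - score d σ P y‖ ^ 2 * smoothedDensity d σ P y := by
    refine htotal.mono' (by fun_prop) (ae_of_all _ fun y => ?_)
    rw [Real.norm_of_nonneg (mul_nonneg (by positivity) (smoothedDensity_pos P hσ y).le)]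
    exact le_add_of_nonneg_right (integral_nonneg fun x =>
      mul_nonneg (by positivity) (gaussKernel_nonneg _ _))
  have hvar := htotal.sub hdirect
  simp only [Pi.sub_def, add_sub_cancel_left] at hvar
  unfold lDenoise lDirect
  rw [integral_integral_swap hintegrable, ← integral_add hdirect hvar]
  simp only [integral_half_sq_norm_sub_mul_gaussKernel P hσ (g _)]

end GaussianSmoothing

/-- Minimizing the denoising objective is equivalent to minimizing the direct objective:
the order on bounded measurable functions induced by the two objectives coincides. -/
theorem denoising_le_iff_direct_le
    (d : ℕ) (hd : 1 ≤ d)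
    (P : Measure (EuclideanSpace ℝ (Fin d))) [IsProbabilityMeasure P]
    (hP : ∃ K : Set (EuclideanSpace ℝ (Fin d)), IsCompact K ∧ P Kᶜ = 0)
    (σ : ℝ) (hσ : 0 < σ)
    (g₁ g₂ : EuclideanSpace ℝ (Fin d) → EuclideanSpace ℝ (Fin d))
    (hg₁ : Measurable g₁) (hg₁b : ∃ C : ℝ, ∀ y, ‖g₁ y‖ ≤ C)
    (hg₂ : Measurable g₂) (hg₂b : ∃ C : ℝ, ∀ y, ‖g₂ y‖ ≤ C) :
    lDenoise d σ P g₁ ≤ lDenoise d σ P g₂ ↔ lDirect d σ P g₁ ≤ lDirect d σ P g₂ := by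
  rw [lDenoise_eq_lDirect_add P hσ hg₁ hg₁b, lDenoise_eq_lDirect_add P hσ hg₂ hg₂b,
    add_le_add_iff_right]
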